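/- Let n ≥ 3, let m₁,…,mₙ > 0, and let h, c ∈ ℂ. In the polynomial ring ℂ[r,p,d] with variables r = (r₁,…,rₙ) ∈ (ℂ²)ⁿ, p = (p₁,…,pₙ) ∈ (ℂ²)ⁿ and d = (d_{ij})_{1≤i<j≤n}, consider the localization R away from the product ∏_{i<j} d_{ij}. Then the ideal of R generated by the elements d_{ij}² − |r_i − r_j|² (for 1 ≤ i < j ≤ n), the two components of ∑_{i} m_i r_i, the two components of ∑_i p_i, C(r,p) − c where C(r,p) = ∑_i (r_i)ᵀ J₂ᵀ p_i with J₂ = [[0,−1],[1,0]], and H(r,p,d) − h where H(r,p,d) = (1/2)∑_i |p_i|²/m_i − ∑_{1≤i<j≤n} m_i m_j/d_{ij}, is a prime ideal; equivalently, the common level variety 𝓜_{h,c} is an irreducible algebraic variety. -/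

import Mathlib

open MvPolynomial

/-- Variables of the polynomial ring `ℂ[r, p, d]`: positions `r_{i,a}`, momenta `p_{i,a}`
(`i ∈ Fin n`, `a ∈ Fin 2`), and mutual distances `d_{ij}` for `i < j`. -/
abbrev NBVar (n : ℕ) :=
  (Fin n × Fin 2) ⊕ (Fin n × Fin 2) ⊕ {q : Fin n × Fin n // q.1 < q.2}

/-- The position variable `r_{i,a}`. -/
noncomputable def rX {n : ℕ} (i : Fin n) (a : Fin 2) : MvPolynomial (NBVar n) ℂ :=
  X (Sum.inl (i, a))

/-- The momentum variable `p_{i,a}`. -/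
noncomputable def pX {n : ℕ} (i : Fin n) (a : Fin 2) : MvPolynomial (NBVar n) ℂ :=
  X (Sum.inr (Sum.inl (i, a)))

/-- The mutual-distance variable `d_{ij}`. -/
noncomputable def dX {n : ℕ} (q : {q : Fin n × Fin n // q.1 < q.2}) :
    MvPolynomial (NBVar n) ℂ :=
  X (Sum.inr (Sum.inr q))

/-- The product `∏_{i<j} d_{ij}`. -/
noncomputable def dProd (n : ℕ) : MvPolynomial (NBVar n) ℂ :=
  ∏ q : {q : Fin n × Fin n // q.1 < q.2}, dX q

/-- The localization of `ℂ[r,p,d]` away from `∏_{i<j} d_{ij}`. -/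
abbrev NBRing (n : ℕ) := Localization.Away (dProd n)

/-- The localization map `ℂ[r,p,d] → R`. -/
noncomputable def toLoc (n : ℕ) : MvPolynomial (NBVar n) ℂ →+* NBRing n :=
  algebraMap (MvPolynomial (NBVar n) ℂ) (NBRing n)


/-- A family is square-independent on `s` when no nonempty subproduct is a square in the
fraction field. -/
def SqIndep {A ι : Type} [CommRing A] (s : Finset ι) (a : ι → A) : Prop :=
  ∀ t ⊆ s, t.Nonempty → ∀ x y : A, x ^ 2 * ∏ i ∈ t, a i = y ^ 2 → x = 0

theorem quad_isDomain {A : Type} [CommRing A] [IsDomain A] (a : A)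
    (ha : ∀ x y : A, x ^ 2 * a = y ^ 2 → x = 0) : IsDomain (QuadraticAlgebra A a 0) := by
  have hN : ∀ z : QuadraticAlgebra A a 0, z.norm = 0 → z = 0 := by
    intro z hz
    rw [QuadraticAlgebra.norm_def] at hz
    have h1 := ha z.im z.re (by linear_combination -hz)
    rw [h1] at hz
    have h2 : z.re = 0 := by simpa using hz
    ext <;> simp [h1, h2]
  have : NoZeroDivisors (QuadraticAlgebra A a 0) := ⟨by
    intro x y hxy
    have := congrArg QuadraticAlgebra.norm hxy
    rw [map_mul, QuadraticAlgebra.norm_zero, mul_eq_zero] at this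
    exact this.imp (hN _) (hN _)⟩
  exact NoZeroDivisors.to_isDomain _

theorem quad_sqIndep {A ι : Type} [CommRing A] [IsDomain A] [DecidableEq ι] (h2 : (2 : A) ≠ 0)
    (i : ι) (s : Finset ι) (hi : i ∉ s) (a : ι → A) (h : SqIndep (insert i s) a) :
    SqIndep s (fun j => algebraMap A (QuadraticAlgebra A (a i) 0) (a j)) := by
  have ha : ∀ x y : A, x ^ 2 * a i = y ^ 2 → x = 0 := by
    intro x y hxy
    exact h {i} (by simp) (by simp) x y (by simpa using hxy)
  have := quad_isDomain (a i) ha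
  intro t ht hne x y hxy
  rw [← map_prod] at hxy
  set b := ∏ j ∈ t, a j with hb
  by_contra hx
  have hn : x.norm ≠ 0 := by
    intro h0
    have := QuadraticAlgebra.algebraMap_norm_eq_mul_star x
    rw [h0, map_zero, eq_comm, mul_eq_zero, star_eq_zero] at this
    exact hx (this.elim id id)
  set e := y * star x with he
  have key : algebraMap A (QuadraticAlgebra A (a i) 0) (x.norm ^ 2 * b) = e ^ 2 := by
    rw [map_mul, map_pow, QuadraticAlgebra.algebraMap_norm_eq_mul_star, he, mul_pow, mul_pow,
      ← hxy]
    ring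
  have hre := congrArg QuadraticAlgebra.re key
  have him := congrArg QuadraticAlgebra.im key
  simp only [pow_two, QuadraticAlgebra.re_mul, QuadraticAlgebra.im_mul,
    QuadraticAlgebra.algebraMap_re, QuadraticAlgebra.algebraMap_im] at hre him
  have h3 : 2 * (e.re * e.im) = 0 := by linear_combination -him
  rcases mul_eq_zero.1 ((mul_eq_zero.1 h3).resolve_left h2) with h0 | h0
  · rw [h0] at hre
    apply hn
    refine h (insert i t) (Finset.insert_subset_insert _ ht) (by simp) _ (a i * e.im) ?_
    rw [Finset.prod_insert (fun hh => hi (ht hh)), ← hb]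
    linear_combination a i * hre
  · rw [h0] at hre
    apply hn
    refine h t (ht.trans (Finset.subset_insert _ _)) hne _ e.re ?_
    rw [← hb]
    linear_combination hre

theorem tower {ι : Type} [DecidableEq ι] (s : Finset ι) :
    ∀ (A : Type) [CommRing A] [IsDomain A] (_ : (2 : A) ≠ 0) (a : ι → A) (_ : SqIndep s a),
    ∃ (B : Type) (_ : CommRing B) (_ : IsDomain B) (f : A →+* B) (d : ι → B),
      Function.Injective f ∧ (∀ i ∈ s, d i ^ 2 = f (a i)) ∧
      ∀ (T : Type) [CommRing T] (g : A →+* T) (e : ι → T), (∀ i ∈ s, e i ^ 2 = g (a i)) →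
        ∃ G : B →+* T, G.comp f = g ∧ ∀ i ∈ s, G (d i) = e i := by
  induction s using Finset.induction_on with
  | empty =>
    intro A _ _ _ a _
    exact ⟨A, inferInstance, inferInstance, RingHom.id A, fun _ => 0, Function.injective_id,
      by simp, fun T _ g e _ => ⟨g, by simp, by simp⟩⟩
  | insert i s hi ih =>
    intro A _ _ h2 a h
    have := quad_isDomain (a i) (fun x y hxy =>
      h {i} (by simp) (by simp) x y (by simpa using hxy))
    have h2' : (2 : QuadraticAlgebra A (a i) 0) ≠ 0 := by
      intro h0
      have := congrArg QuadraticAlgebra.re h0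
      exact h2 this
    obtain ⟨B, _, _, f, d, hf, hd, hu⟩ := ih (QuadraticAlgebra A (a i) 0) h2' _
      (quad_sqIndep h2 i s hi a h)
    refine ⟨B, inferInstance, inferInstance, f.comp (algebraMap _ _),
      Function.update d i (f QuadraticAlgebra.omega), 
      hf.comp QuadraticAlgebra.algebraMap_injective, ?_, ?_⟩
    · intro j hj
      by_cases hji : j = i
      · subst hji
        rw [Function.update_self, ← map_pow, pow_two,
          QuadraticAlgebra.omega_mul_omega_eq_mk]
        rfl
      · rw [Function.update_of_ne hji]
        exact hd j ((Finset.mem_insert.1 hj).resolve_left hji)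
    · intro T _ g e he
      let _ := g.toAlgebra
      let g' : QuadraticAlgebra A (a i) 0 →ₐ[A] T := QuadraticAlgebra.lift ⟨e i, by
        rw [zero_smul, add_zero, ← pow_two, he i (by simp), Algebra.smul_def, mul_one]; rfl⟩
      have hg' : ∀ x, g' (algebraMap _ _ x) = g x := fun x => g'.commutes x
      obtain ⟨G, hG, hGe⟩ := hu T g'.toRingHom e (fun j hj => by
        rw [he j (by simp [hj])]
        exact (hg' _).symm)
      refine ⟨G, ?_, ?_⟩
      · rw [← RingHom.comp_assoc, hG]
        ext x
        exact hg' x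
      · intro j hj
        by_cases hji : j = i
        · subst hji
          rw [Function.update_self]
          have := RingHom.congr_fun hG QuadraticAlgebra.omega
          rw [RingHom.comp_apply] at this
          rw [this]
          simp [g', QuadraticAlgebra.lift]
        · rw [Function.update_of_ne hji]
          exact hGe j ((Finset.mem_insert.1 hj).resolve_left hji)

open MvPolynomial in
theorem prime_X_sub_X {σ : Type} (i j : σ) (hij : i ≠ j) :
    Prime (X i - X j : MvPolynomial σ ℂ) := by
  classical
  rw [← UniqueFactorizationMonoid.irreducible_iff_prime]
  have := irreducible_mul_X_add (1 : MvPolynomial σ ℂ) (-X j) i one_ne_zero (by simp)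
    (by simp [hij]) isRelPrime_one_left
  simpa [sub_eq_add_neg] using this

abbrev PairIdx (n : ℕ) := {q : Fin n × Fin n // q.1 < q.2}

open MvPolynomial in
/-- the squared distances in null coordinates -/
noncomputable def sqd {n : ℕ} (q : PairIdx n) : MvPolynomial (Fin n ⊕ Fin n) ℂ :=
  (X (Sum.inl q.1.1) - X (Sum.inl q.1.2)) * (X (Sum.inr q.1.1) - X (Sum.inr q.1.2))

theorem odd_mult {A : Type} [CommRing A] [IsDomain A] [WfDvdMonoid A] (p g x y : A)
    (hp : Prime p) (hg : ¬ p ∣ g) (h : x ^ 2 * (p * g) = y ^ 2) : x = 0 := by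
  by_contra hx
  have hg0 : g ≠ 0 := fun h0 => hg (h0 ▸ dvd_zero _)
  have hy : y ≠ 0 := by
    rintro rfl
    have : x ^ 2 * (p * g) = 0 := by simpa using h
    simp [hx, hg0, hp.ne_zero] at this
  have h1 := congrArg (emultiplicity p) h
  have fx := FiniteMultiplicity.of_prime_left hp hx
  have fy := FiniteMultiplicity.of_prime_left hp hy
  have fp := FiniteMultiplicity.of_prime_left hp hp.ne_zero
  rw [emultiplicity_mul hp, emultiplicity_mul hp, emultiplicity_pow hp, emultiplicity_pow hp,
    emultiplicity_eq_zero.2 hg, fx.emultiplicity_eq_multiplicity,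
    fy.emultiplicity_eq_multiplicity, fp.emultiplicity_self] at h1
  norm_cast at h1
  omega

open MvPolynomial in
theorem sqd_indep (n : ℕ) (s : Finset (PairIdx n)) : SqIndep s (sqd (n := n)) := by
  classical
  intro t _ ⟨q, hq⟩ x y hxy
  have hqne : q.1.1 ≠ q.1.2 := ne_of_lt q.2
  have hp := prime_X_sub_X (σ := Fin n ⊕ Fin n) (Sum.inl q.1.1) (Sum.inl q.1.2)
    (fun hh => hqne (Sum.inl_injective hh))
  rw [← Finset.mul_prod_erase t _ hq] at hxy
  conv at hxy => enter [1, 2, 1]; rw [sqd]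
  rw [mul_assoc] at hxy
  refine odd_mult _ _ x y hp ?_ hxy
  -- evaluation at points of the hyperplane
  have ev : ∀ (v : Fin n ⊕ Fin n → ℂ), v (Sum.inl q.1.1) = v (Sum.inl q.1.2) →
      ∀ f : MvPolynomial (Fin n ⊕ Fin n) ℂ,
      (X (Sum.inl q.1.1) - X (Sum.inl q.1.2) : MvPolynomial (Fin n ⊕ Fin n) ℂ) ∣ f →
      eval v f = 0 := by
    rintro v hv f ⟨g, rfl⟩
    simp [hv]
  have evr : ∀ k l : Fin n, k ≠ l →
      ¬ (X (Sum.inl q.1.1) - X (Sum.inl q.1.2) : MvPolynomial (Fin n ⊕ Fin n) ℂ) ∣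
        (X (Sum.inr k) - X (Sum.inr l)) := by
    intro k l hkl hd
    have := ev (Pi.single (Sum.inr k) 1) (by simp) _ hd
    simp [hkl.symm] at this
  have evl : ∀ k l : Fin n, k < l → ¬ (k = q.1.1 ∧ l = q.1.2) →
      ¬ (X (Sum.inl q.1.1) - X (Sum.inl q.1.2) : MvPolynomial (Fin n ⊕ Fin n) ℂ) ∣
        (X (Sum.inl k) - X (Sum.inl l)) := by
    intro k l hkl hne hd
    have hlt := q.2
    by_cases hk : k ≠ q.1.1 ∧ k ≠ q.1.2
    · have := ev (Pi.single (Sum.inl k) 1) (by simp [hk.1.symm, hk.2.symm]) _ hd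
      simp [hkl.ne'] at this
    · have hl : l ≠ q.1.1 ∧ l ≠ q.1.2 := by
        constructor
        · rintro rfl
          apply hk
          exact ⟨hkl.ne, (hkl.trans hlt).ne⟩
        · rintro rfl
          exact hk ⟨fun hh => hne ⟨hh, rfl⟩, hkl.ne⟩
      have := ev (Pi.single (Sum.inl l) 1) (by simp [hl.1.symm, hl.2.symm]) _ hd
      simp [hkl.ne] at this
  intro hd
  rcases hp.dvd_or_dvd hd with hd | hd
  · exact evr _ _ hqne hd
  · obtain ⟨q', hq', hd⟩ := hp.exists_mem_finset_dvd hd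
    rw [sqd] at hd
    rcases hp.dvd_or_dvd hd with hd | hd
    · refine evl _ _ q'.2 ?_ hd
      rintro ⟨h1, h2⟩
      exact (Finset.mem_erase.1 hq').1 (Subtype.ext (Prod.ext h1 h2))
    · exact evr _ _ (ne_of_lt q'.2) hd

open MvPolynomial in
/-- The configuration ring: a domain, universal for configurations with invertible distances. -/
theorem config_ring (n : ℕ) :
    ∃ (S : Type) (_ : CommRing S) (_ : IsDomain S) (k : ℂ →+* S) (x y : Fin n → S)
      (d e : PairIdx n → S),
      (∀ q, d q * e q = 1) ∧ (∀ q, d q ^ 2 = (x q.1.1 - x q.1.2) * (y q.1.1 - y q.1.2)) ∧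
      ∀ (T : Type) [CommRing T] (k' : ℂ →+* T) (x' y' : Fin n → T) (d' e' : PairIdx n → T),
        (∀ q, d' q * e' q = 1) →
        (∀ q, d' q ^ 2 = (x' q.1.1 - x' q.1.2) * (y' q.1.1 - y' q.1.2)) →
        ∃ G : S →+* T, (∀ z, G (k z) = k' z) ∧ (∀ i, G (x i) = x' i) ∧ (∀ i, G (y i) = y' i) ∧
          (∀ q, G (d q) = d' q) ∧ (∀ q, G (e q) = e' q) := by
  classical
  obtain ⟨B, _, _, f, d, hf, hd, hu⟩ := tower (Finset.univ : Finset (PairIdx n))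
    (MvPolynomial (Fin n ⊕ Fin n) ℂ) two_ne_zero sqd (sqd_indep n _)
  have hd0 : ∀ q, d q ≠ 0 := by
    intro q h0
    have h1 := hd q (by simp)
    rw [h0, zero_pow two_ne_zero, eq_comm, map_eq_zero_iff f hf] at h1
    have hqne : q.1.1 ≠ q.1.2 := ne_of_lt q.2
    rw [sqd, mul_eq_zero] at h1
    rcases h1 with h1 | h1
    · exact (prime_X_sub_X _ _ (fun hh => hqne (Sum.inl_injective hh))).ne_zero h1
    · exact (prime_X_sub_X _ _ (fun hh => hqne (Sum.inr_injective hh))).ne_zero h1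
  set D := ∏ q, d q with hD
  have hD0 : D ≠ 0 := Finset.prod_ne_zero_iff.2 (fun q _ => hd0 q)
  let S := Localization.Away D
  have hS : IsDomain S := IsLocalization.isDomain_localization
    (powers_le_nonZeroDivisors_of_noZeroDivisors hD0)
  let j : B →+* S := algebraMap B S
  have hDu : IsUnit (j D) := IsLocalization.Away.algebraMap_isUnit D
  have hdu : ∀ q, IsUnit (j (d q)) := by
    intro q
    refine isUnit_of_dvd_unit ?_ hDu
    exact map_dvd j (Finset.dvd_prod_of_mem _ (Finset.mem_univ q))
  choose e he using fun q => (hdu q).exists_right_inv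
  refine ⟨S, inferInstance, hS, j.comp (f.comp C), fun i => j (f (X (Sum.inl i))),
    fun i => j (f (X (Sum.inr i))), fun q => j (d q), e, he, ?_, ?_⟩
  · intro q
    rw [← map_pow, hd q (Finset.mem_univ q), sqd]
    simp only [map_mul, map_sub]
  · intro T _ k' x' y' d' e' hde hd'
    obtain ⟨G, hG, hGd⟩ := hu T (eval₂Hom k' (Sum.elim x' y')) d' (by
      intro q _
      rw [hd', sqd]
      simp)
    have hGf : ∀ z, G (f z) = eval₂Hom k' (Sum.elim x' y') z := fun z => RingHom.congr_fun hG z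
    have hGD : IsUnit (G D) := by
      rw [hD, map_prod]
      refine (IsUnit.prod_univ_iff).2 (fun q => ?_)
      rw [hGd q (Finset.mem_univ q)]
      exact IsUnit.of_mul_eq_one _ (hde q)
    let G' : S →+* T := IsLocalization.Away.lift D hGD
    have hG' : ∀ b, G' (j b) = G b := fun b => IsLocalization.Away.lift_eq D hGD b
    refine ⟨G', ?_, ?_, ?_, ?_, ?_⟩
    · intro z; simp [hG', hGf]
    · intro z; simp [hG', hGf]
    · intro z; simp [hG', hGf]
    · intro q; simp [hG', hGd]
    · intro q
      have h1 : d' q * G' (e q) = 1 := by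
        rw [← hGd q (Finset.mem_univ q), ← hG', ← map_mul, he, map_one]
      have h2 := hde q
      linear_combination e' q * h1 - G' (e q) * h2

/-- The potential is not constant. -/
theorem config_potential_ne {n : ℕ} {S : Type} [CommRing S] [IsDomain S] (k : ℂ →+* S)
    (x y : Fin n → S) (d e : PairIdx n → S)
    (hde : ∀ q, d q * e q = 1)
    (hd : ∀ q, d q ^ 2 = (x q.1.1 - x q.1.2) * (y q.1.1 - y q.1.2))
    (hu : ∀ (k' : ℂ →+* S) (x' y' : Fin n → S) (d' e' : PairIdx n → S),
        (∀ q, d' q * e' q = 1) →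
        (∀ q, d' q ^ 2 = (x' q.1.1 - x' q.1.2) * (y' q.1.1 - y' q.1.2)) →
        ∃ G : S →+* S, (∀ z, G (k z) = k' z) ∧ (∀ i, G (x i) = x' i) ∧ (∀ i, G (y i) = y' i) ∧
          (∀ q, G (d q) = d' q) ∧ (∀ q, G (e q) = e' q))
    (q₀ : PairIdx n) (h : ℂ) (μ : PairIdx n → ℂ) (hμ : μ q₀ ≠ 0) :
    k h + ∑ q, k (μ q) * e q ≠ 0 := by
  classical
  intro h0
  obtain ⟨G, hGk, -, -, -, hGe⟩ := hu k x y (Function.update d q₀ (- d q₀))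
    (Function.update e q₀ (- e q₀))
    (by
      intro q
      by_cases hq : q = q₀
      · subst hq; simp [hde]
      · simp [hq, hde])
    (by
      intro q
      by_cases hq : q = q₀
      · subst hq; simp [hd]
      · simp [hq, hd])
  have h1 := congrArg G h0
  simp only [map_add, map_sum, map_mul, hGk, hGe, map_zero] at h1
  rw [← Finset.add_sum_erase _ _ (Finset.mem_univ q₀)] at h0 h1
  have h2 : ∑ q ∈ Finset.univ.erase q₀, k (μ q) * Function.update e q₀ (- e q₀) q =
      ∑ q ∈ Finset.univ.erase q₀, k (μ q) * e q :=
    Finset.sum_congr rfl (fun q hq => by rw [Function.update_of_ne (Finset.ne_of_mem_erase hq)])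
  rw [h2, Function.update_self] at h1
  have h3 : k 2 * (k (μ q₀) * e q₀) = 0 := by
    rw [map_ofNat]
    linear_combination h0 - h1
  have hk : ∀ z : ℂ, z ≠ 0 → k z ≠ 0 := fun z hz hh => hz ((map_eq_zero k).1 hh)
  have he : e q₀ ≠ 0 := fun hh => by simpa [hh] using hde q₀
  exact mul_ne_zero (hk 2 two_ne_zero) (mul_ne_zero (hk _ hμ) he) h3

open Polynomial in
/-- `a X + b` is prime in `D[X]` when `a` is prime and does not divide `b`. -/
theorem prime_linear {D : Type} [CommRing D] [IsDomain D] (a b : D) (ha : Prime a)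
    (hab : ¬ a ∣ b) : Prime (Polynomial.C a * Polynomial.X + Polynomial.C b : D[X]) := by
  let K := FractionRing D
  have hj : Function.Injective (algebraMap D K) := IsFractionRing.injective D K
  have ha0 : algebraMap D K a ≠ 0 := fun h => ha.ne_zero (hj (by rw [h, map_zero]))
  let φ : D[X] →+* K := eval₂RingHom (algebraMap D K) (-(algebraMap D K b) / algebraMap D K a)
  set F : D[X] := Polynomial.C a * Polynomial.X + Polynomial.C b with hF
  have hφF : φ F = 0 := by
    have : φ F = algebraMap D K a * (-(algebraMap D K b) / algebraMap D K a)
        + algebraMap D K b := by simp [φ, hF]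
    rw [this, mul_div_cancel₀ _ ha0, neg_add_cancel]
  have hCa : Prime (Polynomial.C a : D[X]) := prime_C_iff.2 ha
  have hCF : ¬ (Polynomial.C a : D[X]) ∣ F := by
    intro hd
    have h1 : (Polynomial.C a : D[X]) ∣ Polynomial.C b := (dvd_add_right (dvd_mul_right _ _)).1 hd
    obtain ⟨g, hg⟩ := h1
    apply hab
    refine ⟨g.coeff 0, ?_⟩
    have := congrArg (fun p : D[X] => p.coeff 0) hg
    simpa using this
  -- removing factors of `a`
  have hdiv : ∀ (k : ℕ) (g : D[X]), F ∣ Polynomial.C a ^ k * g → F ∣ g := by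
    intro k
    induction k with
    | zero => intro g hg; simpa using hg
    | succ k ih =>
      intro g hg
      apply ih
      obtain ⟨q, hq⟩ := hg
      have h1 : (Polynomial.C a : D[X]) ∣ F * q := ⟨Polynomial.C a ^ k * g, by rw [← hq]; ring⟩
      obtain ⟨q', hq'⟩ := (hCa.dvd_or_dvd h1).resolve_left hCF
      refine ⟨q', ?_⟩
      apply mul_left_cancel₀ hCa.ne_zero
      rw [hq'] at hq
      linear_combination hq
  -- pseudo-division
  have hred : ∀ g : D[X], ∃ (k : ℕ) (r : D), F ∣ Polynomial.C a ^ k * g - Polynomial.C r := by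
    intro g
    induction g using Polynomial.induction_on' with
    | add p q hp hq =>
      obtain ⟨k, r, u, hu⟩ := hp
      obtain ⟨l, s, v, hv⟩ := hq
      refine ⟨k + l, a ^ l * r + a ^ k * s, Polynomial.C a ^ l * u + Polynomial.C a ^ k * v, ?_⟩
      simp only [map_add, map_mul, map_pow]
      linear_combination Polynomial.C a ^ l * hu + Polynomial.C a ^ k * hv
    | monomial n c =>
      refine ⟨n, c * (-b) ^ n, ?_⟩
      have : (Polynomial.C a ^ n * monomial n c - Polynomial.C (c * (-b) ^ n) : D[X]) =
          Polynomial.C c * ((Polynomial.C a * Polynomial.X) ^ n - (-Polynomial.C b) ^ n) := by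
        rw [← Polynomial.C_mul_X_pow_eq_monomial]
        simp only [map_mul, map_pow, map_neg]
        ring
      rw [this]
      have h2 := sub_dvd_pow_sub_pow (Polynomial.C a * Polynomial.X : D[X]) (-Polynomial.C b) n
      rw [sub_neg_eq_add] at h2
      exact dvd_mul_of_dvd_right h2 _
  have hker : ∀ g : D[X], φ g = 0 → F ∣ g := by
    intro g hg
    obtain ⟨k, r, u, hu⟩ := hred g
    have h1 := congrArg φ hu
    rw [map_sub, map_mul, hg, map_mul, hφF] at h1
    have h2 : φ (Polynomial.C r) = algebraMap D K r := by simp [φ]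
    rw [h2] at h1
    have h3 : r = 0 := hj (by rw [map_zero]; linear_combination -h1)
    apply hdiv k
    refine ⟨u, ?_⟩
    rw [h3, map_zero, sub_zero] at hu
    exact hu
  refine ⟨?_, ?_, ?_⟩
  · intro h0
    exact hCF (h0 ▸ dvd_zero _)
  · intro hu
    have := hu.map φ
    rw [hφF] at this
    exact not_isUnit_zero this
  · intro p q hpq
    obtain ⟨g, hg⟩ := hpq
    have := congrArg φ hg
    rw [map_mul, map_mul, hφF, zero_mul, mul_eq_zero] at this
    exact this.imp (hker p) (hker q)

/-- Completing a configuration domain to the full level variety. -/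
theorem momentum_ring {n : ℕ} (i0 i1 i2 : Fin n) (h01 : i0 ≠ i1) (h02 : i0 ≠ i2)
    {S : Type} [CommRing S] [IsDomain S] (m μ u w : Fin n → S) (N v01 v12 c2 h2 : S)
    (hmμ : ∀ i, m i * μ i = 1) (hN : N * ∑ i, m i = 1)
    (hv01 : v01 * (w i0 - w i1) = 1) (hv12 : v12 * (w i1 - w i2) = 1) (hh2 : h2 ≠ 0) :
    ∃ (Ω : Type) (_ : CommRing Ω) (_ : IsDomain Ω) (j : S →+* Ω) (P Q : Fin n → Ω),
      (∑ i, P i = 0 ∧ ∑ i, Q i = 0 ∧ ∑ i, (j (w i) * P i - j (u i) * Q i) = j c2 ∧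
        ∑ i, j (μ i) * (P i * Q i) = j h2) ∧
      ∀ (T : Type) [CommRing T] (g : S →+* T) (P' Q' : Fin n → T),
        (∑ i, P' i = 0 ∧ ∑ i, Q' i = 0 ∧ ∑ i, (g (w i) * P' i - g (u i) * Q' i) = g c2 ∧
          ∑ i, g (μ i) * (P' i * Q' i) = g h2) →
        ∃ G : Ω →+* T, G.comp j = g ∧ (∀ i, G (P i) = P' i) ∧ (∀ i, G (Q i) = Q' i) := by
  classical
  let D := MvPolynomial (Fin n ⊕ Fin n) S
  let C : S →+* D := MvPolynomial.C
  let κ : Fin n → S := Pi.single i0 (w i1 - w i2) + Pi.single i1 (w i2 - w i0)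
    + Pi.single i2 (w i0 - w i1)
  let ε : Fin n → S := Pi.single i0 1 - Pi.single i1 1
  have hκ : ∀ {T : Type} [CommRing T] (g : S →+* T) (z : Fin n → T), ∑ i, g (κ i) * z i =
      g (w i1 - w i2) * z i0 + g (w i2 - w i0) * z i1 + g (w i0 - w i1) * z i2 := by
    intro T _ g z
    simp [κ, Pi.single_apply, add_mul, Finset.sum_add_distrib, apply_ite g]
  have hε : ∀ {T : Type} [CommRing T] (g : S →+* T) (z : Fin n → T), ∑ i, g (ε i) * z i =
      z i0 - z i1 := by
    intro T _ g z
    simp [ε, Pi.single_apply, sub_mul, Finset.sum_sub_distrib, apply_ite g]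
  let Y : D := MvPolynomial.X (Sum.inr i0)
  let p0 : Fin n → D := fun i => MvPolynomial.X (Sum.inl i)
  let q0 : Fin n → D := fun i => MvPolynomial.X (Sum.inr i)
  let q1 : Fin n → D := Function.update q0 i0 (C (v12 * m i0) *
    (Y - C ((w i2 - w i0) * μ i1) * q0 i1 - C ((w i0 - w i1) * μ i2) * q0 i2))
  let q2 : Fin n → D := fun i => q1 i - C (m i * N) * ∑ l, q1 l
  let p1 : Fin n → D := fun i => p0 i - C (m i * N) * ∑ l, p0 l
  let τ : D := C v01 * (C c2 - ∑ i, (C (w i) * p1 i - C (u i) * q2 i))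
  let p2 : Fin n → D := fun i => p1 i + C (ε i) * τ
  let B : D := ∑ i, C (μ i) * (p2 i * q2 i) - C h2
  have hNC : ∑ i, C (m i * N) = 1 := by
    rw [← map_sum, ← Finset.sum_mul, mul_comm, hN, map_one]
  have hq10 : q1 i0 = C (v12 * m i0) *
    (Y - C ((w i2 - w i0) * μ i1) * q0 i1 - C ((w i0 - w i1) * μ i2) * q0 i2) := by
    simp [q1]
  have hq1n : ∀ i, i ≠ i0 → q1 i = q0 i := fun i hi => by simp [q1, hi]
  have hq2s : ∑ i, q2 i = 0 := by
    simp only [q2, Finset.sum_sub_distrib, ← Finset.sum_mul, hNC, one_mul, sub_self]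
  have hp1s : ∑ i, p1 i = 0 := by
    simp only [p1, Finset.sum_sub_distrib, ← Finset.sum_mul, hNC, one_mul, sub_self]
  have hp2s : ∑ i, p2 i = 0 := by
    simp only [p2, Finset.sum_add_distrib, hp1s, hε, sub_self, add_zero]
  have hmC : ∀ i, C (m i) * C (μ i) = 1 := fun i => by rw [← map_mul, hmμ, map_one]
  have hv12C : C v12 * (C (w i1) - C (w i2)) = 1 := by
    rw [← map_sub, ← map_mul, hv12, map_one]
  have hv01C : C v01 * (C (w i0) - C (w i1)) = 1 := by
    rw [← map_sub, ← map_mul, hv01, map_one]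
  have hκq2 : ∑ i, C (κ i) * (C (μ i) * q2 i) = Y := by
    rw [hκ C]
    simp only [q2, hq10, hq1n i1 h01.symm, hq1n i2 h02.symm]
    generalize ∑ l, q1 l = s
    have e0 := hmC i0
    have e1 := hmC i1
    have e2 := hmC i2
    simp only [map_mul, map_sub]
    set Z := Y - (C (w i2) - C (w i0)) * C (μ i1) * q0 i1
      - (C (w i0) - C (w i1)) * C (μ i2) * q0 i2 with hZ
    linear_combination (C (w i1) - C (w i2)) * (C v12 * Z - C N * s) * e0
      - (C (w i2) - C (w i0)) * C N * s * e1 - (C (w i0) - C (w i1)) * C N * s * e2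
      + Z * hv12C + hZ
  have hCp2 : ∑ i, (C (w i) * p2 i - C (u i) * q2 i) = C c2 := by
    have e1 : ∀ i, C (w i) * p2 i - C (u i) * q2 i =
        (C (w i) * p1 i - C (u i) * q2 i) + C (ε i) * (C (w i) * τ) := fun i => by
      simp only [p2]; ring
    simp only [e1, Finset.sum_add_distrib]
    rw [hε C]
    have hτ : τ = C v01 * (C c2 - ∑ i, (C (w i) * p1 i - C (u i) * q2 i)) := rfl
    linear_combination (C (w i0) - C (w i1)) * hτ
      + (C c2 - ∑ i, (C (w i) * p1 i - C (u i) * q2 i)) * hv01C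
  have hYB : ¬ Y ∣ B := by
    rintro ⟨g, hg⟩
    have hq0c : ∀ i, MvPolynomial.constantCoeff (q0 i) = 0 := fun i =>
      MvPolynomial.constantCoeff_X S _
    have hYc : MvPolynomial.constantCoeff Y = 0 := MvPolynomial.constantCoeff_X S _
    have hq1c : ∀ i, MvPolynomial.constantCoeff (q1 i) = 0 := by
      intro i
      by_cases hi : i = i0
      · subst hi
        rw [hq10]
        simp only [map_mul, map_sub, hq0c, hYc]
        ring
      · rw [hq1n i hi, hq0c]
    have hq2c : ∀ i, MvPolynomial.constantCoeff (q2 i) = 0 := by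
      intro i
      simp only [q2, map_sub, map_mul, map_sum, hq1c]
      simp
    have h1 := congrArg MvPolynomial.constantCoeff hg
    rw [map_mul, hYc, zero_mul] at h1
    simp only [B, map_sub, map_sum, map_mul, hq2c, mul_zero, Finset.sum_const_zero, zero_sub,
      neg_eq_zero] at h1
    exact hh2 ((MvPolynomial.constantCoeff_C _ _).symm.trans h1)
  have hYp : Prime Y := MvPolynomial.X_prime
  have hF := prime_linear Y B hYp hYB
  set F : Polynomial D := Polynomial.C Y * Polynomial.X + Polynomial.C B with hFd
  have hprime : (Ideal.span {F}).IsPrime := (Ideal.span_singleton_prime hF.ne_zero).2 hF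
  let π : Polynomial D →+* (Polynomial D ⧸ Ideal.span {F}) := Ideal.Quotient.mk _
  have hπF : π F = 0 := Ideal.Quotient.eq_zero_iff_mem.2 (Ideal.mem_span_singleton_self F)
  let j' : D →+* (Polynomial D ⧸ Ideal.span {F}) := π.comp Polynomial.C
  let ξ := π Polynomial.X
  have hrel : j' Y * ξ + j' B = 0 := by
    have e : π F = π (Polynomial.C Y * Polynomial.X) + π (Polynomial.C B) := map_add π _ _
    rw [map_mul] at e
    exact e.symm.trans hπF
  refine ⟨Polynomial D ⧸ Ideal.span {F}, inferInstance, Ideal.Quotient.isDomain _,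
    j'.comp C, fun i => j' (p2 i) + j' (C (κ i)) * ξ, fun i => j' (q2 i), ⟨?_, ?_, ?_, ?_⟩, ?_⟩
  · have h1 := hκ (j'.comp C) (fun _ => ξ)
    simp only [RingHom.comp_apply] at h1
    rw [Finset.sum_add_distrib, ← map_sum, hp2s, map_zero, h1]
    simp only [map_sub]
    ring
  · rw [← map_sum, hq2s, map_zero]
  · have h1 := hκ (j'.comp C) (fun i => j' (C (w i)) * ξ)
    simp only [RingHom.comp_apply] at h1 ⊢
    have e1 : ∀ i, j' (C (w i)) * (j' (p2 i) + j' (C (κ i)) * ξ) - j' (C (u i)) * j' (q2 i) =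
        j' (C (w i) * p2 i - C (u i) * q2 i) + j' (C (κ i)) * (j' (C (w i)) * ξ) := by
      intro i
      simp only [map_sub, map_mul]
      ring
    simp only [e1, Finset.sum_add_distrib]
    rw [h1, ← map_sum, hCp2]
    simp only [map_sub]
    ring
  · simp only [RingHom.comp_apply]
    have e1 : ∀ i, j' (C (μ i)) * ((j' (p2 i) + j' (C (κ i)) * ξ) * j' (q2 i)) =
        j' (C (μ i) * (p2 i * q2 i)) + j' (C (κ i) * (C (μ i) * q2 i)) * ξ := by
      intro i
      simp only [map_mul]
      ring
    simp only [e1, Finset.sum_add_distrib, ← Finset.sum_mul]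
    rw [← map_sum, ← map_sum, hκq2]
    have hB : j' B = j' (∑ i, C (μ i) * (p2 i * q2 i)) - j' (C h2) := map_sub _ _ _
    linear_combination hrel - hB
  · rintro T _ g P' Q' ⟨t1, t2, t3, t4⟩
    let G0 : D →+* T := MvPolynomial.eval₂Hom g
      (Sum.elim P' (Function.update Q' i0 (∑ i, g (κ i) * (g (μ i) * Q' i))))
    have gC : ∀ z, G0 (C z) = g z := fun z => MvPolynomial.eval₂Hom_C _ _ _
    have gp0 : ∀ i, G0 (p0 i) = P' i := fun i => MvPolynomial.eval₂Hom_X' _ _ _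
    have gq0 : ∀ i, i ≠ i0 → G0 (q0 i) = Q' i := fun i hi =>
      (MvPolynomial.eval₂Hom_X' _ _ _).trans (Function.update_of_ne hi _ _)
    have gY : G0 Y = ∑ i, g (κ i) * (g (μ i) * Q' i) :=
      (MvPolynomial.eval₂Hom_X' _ _ _).trans (Function.update_self _ _ _)
    have gq1 : ∀ i, G0 (q1 i) = Q' i := by
      intro i
      by_cases hi : i = i0
      · subst hi
        rw [hq10]
        simp only [map_mul, map_sub, gC, gY, gq0 _ h01.symm, gq0 _ h02.symm, hκ g]
        have e0 : g (m i) * g (μ i) = 1 := by rw [← map_mul, hmμ, map_one]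
        have e1 : g v12 * (g (w i1) - g (w i2)) = 1 := by
          rw [← map_sub, ← map_mul, hv12, map_one]
        linear_combination g (m i) * g (μ i) * Q' i * e1 + Q' i * e0
      · rw [hq1n i hi, gq0 i hi]
    have gq2 : ∀ i, G0 (q2 i) = Q' i := by
      intro i
      simp only [q2, map_sub, map_mul, map_sum, gq1, t2, mul_zero, sub_zero]
    have gp1 : ∀ i, G0 (p1 i) = P' i := by
      intro i
      simp only [p1, map_sub, map_mul, map_sum, gp0, t1, mul_zero, sub_zero]
    have gτ : G0 τ = 0 := by
      simp only [τ, map_sub, map_mul, map_sum, gC, gp1, gq2, t3, sub_self, mul_zero]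
    have gp2 : ∀ i, G0 (p2 i) = P' i := by
      intro i
      simp only [p2, map_add, map_mul, gp1, gτ, mul_zero, add_zero]
    have gB : G0 B = 0 := by
      simp only [B, map_sub, map_sum, map_mul, gC, gp2, gq2, t4, sub_self]
    let G1 : Polynomial D →+* T := Polynomial.eval₂RingHom G0 0
    have g1C : ∀ z, G1 (Polynomial.C z) = G0 z := fun z => by simp [G1]
    have g1X : G1 Polynomial.X = 0 := by simp [G1]
    have g1F : G1 F = 0 := by
      rw [hFd, map_add, map_mul, g1X, g1C, g1C, gB, mul_zero, add_zero]
    let G : (Polynomial D ⧸ Ideal.span {F}) →+* T := Ideal.Quotient.lift _ G1 (by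
      intro a ha
      obtain ⟨b, rfl⟩ := Ideal.mem_span_singleton.1 ha
      rw [map_mul, g1F, zero_mul])
    have hGj : ∀ z, G (j' z) = G0 z := fun z => by
      rw [← g1C]; exact Ideal.Quotient.lift_mk _ _ _
    have hGξ : G ξ = 0 := by
      rw [← g1X]; exact Ideal.Quotient.lift_mk _ _ _
    refine ⟨G, ?_, ?_, ?_⟩
    · ext z
      simp only [RingHom.comp_apply, hGj, gC]
    · intro i
      simp only [map_add, map_mul, hGj, hGξ, mul_zero, add_zero, gp2]
    · intro i
      rw [hGj, gq2]

/-- For `n ≥ 3`, positive masses and any `h, c ∈ ℂ`, the ideal of the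
localized ring `R` generated by the distance relations `d_{ij}² − |r_i − r_j|²`, the
center-of-mass and total-momentum relations, `C(r,p) − c`, and `H(r,p,d) − h`, is prime:
the common level variety `𝓜_{h,c}` is an irreducible algebraic variety. -/
theorem level_set_ideal_isPrime (n : ℕ) (hn : 3 ≤ n)
    (m : Fin n → ℝ) (hm : ∀ i, 0 < m i) (h c : ℂ) :
    (Ideal.span
      ((Set.range fun q : {q : Fin n × Fin n // q.1 < q.2} =>
          toLoc n (dX q ^ 2 - ∑ a : Fin 2, (rX q.1.1 a - rX q.1.2 a) ^ 2)) ∪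
        (Set.range fun a : Fin 2 =>
          toLoc n (∑ i : Fin n, MvPolynomial.C ((m i : ℂ)) * rX i a)) ∪
        (Set.range fun a : Fin 2 =>
          toLoc n (∑ i : Fin n, pX i a)) ∪
        {toLoc n ((∑ i : Fin n, (rX i 0 * pX i 1 - rX i 1 * pX i 0))
            - MvPolynomial.C c)} ∪
        {toLoc n (MvPolynomial.C (2⁻¹ : ℂ)
              * ∑ i : Fin n, MvPolynomial.C ((m i : ℂ)⁻¹) * (pX i 0 ^ 2 + pX i 1 ^ 2)
            - MvPolynomial.C h)
          - ∑ q : {q : Fin n × Fin n // q.1 < q.2},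
              toLoc n (MvPolynomial.C ((m q.1.1 : ℂ) * (m q.1.2 : ℂ)))
                * Ring.inverse (toLoc n (dX q))})).IsPrime := by
  classical
  set I : Ideal (NBRing n) := Ideal.span _ with hI
  -- special indices
  let i0 : Fin n := ⟨0, by omega⟩
  let i1 : Fin n := ⟨1, by omega⟩
  let i2 : Fin n := ⟨2, by omega⟩
  have h01 : i0 < i1 := by simp [i0, i1, Fin.lt_def]
  have h12 : i1 < i2 := by simp [i1, i2, Fin.lt_def]
  have h02 : i0 < i2 := h01.trans h12
  let q01 : PairIdx n := ⟨(i0, i1), h01⟩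
  let q12 : PairIdx n := ⟨(i1, i2), h12⟩
  -- masses
  let μ : Fin n → ℂ := fun i => (m i : ℂ)
  have hμ0 : ∀ i, μ i ≠ 0 := fun i =>
    Complex.ofReal_ne_zero.2 (hm i).ne'
  have hM : ∑ i, μ i ≠ 0 := by
    have h1 : 0 < ∑ i, m i := Finset.sum_pos (fun i _ => hm i) ⟨i0, Finset.mem_univ _⟩
    have h2 : ∑ i, μ i = ((∑ i, m i : ℝ) : ℂ) := by simp [μ]
    rw [h2]
    exact_mod_cast h1.ne'
  obtain ⟨S, _, _, k, x, y, d, e, hde, hd, hu⟩ := config_ring n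
  have hpot := config_potential_ne k x y d e hde hd (fun k' x' y' d' e' => hu S k' x' y' d' e')
    q01 h (fun q => μ q.1.1 * μ q.1.2) (mul_ne_zero (hμ0 _) (hμ0 _))
  let N := k (∑ i, μ i)⁻¹
  have hN : N * ∑ i, k (μ i) = 1 := by
    rw [← map_sum, ← map_mul, inv_mul_cancel₀ hM, map_one]
  let u : Fin n → S := fun i => x i - N * ∑ l, k (μ l) * x l
  let w : Fin n → S := fun i => y i - N * ∑ l, k (μ l) * y l
  have hud : ∀ i j, u i - u j = x i - x j := fun i j => by simp only [u]; ring
  have hwd : ∀ i j, w i - w j = y i - y j := fun i j => by simp only [w]; ring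
  have hus : ∑ i, k (μ i) * u i = 0 := by
    simp only [u, mul_sub, Finset.sum_sub_distrib, ← Finset.sum_mul]
    linear_combination -(∑ l, k (μ l) * x l) * hN
  have hws : ∑ i, k (μ i) * w i = 0 := by
    simp only [w, mul_sub, Finset.sum_sub_distrib, ← Finset.sum_mul]
    linear_combination -(∑ l, k (μ l) * y l) * hN
  have hdd : ∀ q : PairIdx n, d q ^ 2 = (u q.1.1 - u q.1.2) * (w q.1.1 - w q.1.2) := fun q => by
    rw [hd, hud, hwd]
  have hinv : ∀ q : PairIdx n,
      (e q ^ 2 * (u q.1.1 - u q.1.2)) * (w q.1.1 - w q.1.2) = 1 := fun q => by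
    have h1 := hdd q
    have h2 := hde q
    linear_combination -(e q) ^ 2 * h1 + (d q * e q + 1) * h2
  obtain ⟨Ω, _, _, j, P, Q, ⟨hP, hQ, hC, hH⟩, hΩ⟩ := momentum_ring i0 i1 i2 h01.ne h02.ne
    (fun i => k (μ i)) (fun i => k (μ i)⁻¹) u w N _ _ (k (2 * Complex.I * c))
    (k 2 * (k h + ∑ q : PairIdx n, k (μ q.1.1 * μ q.1.2) * e q))
    (fun i => by rw [← map_mul, mul_inv_cancel₀ (hμ0 i), map_one]) hN (hinv q01) (hinv q12)
    (mul_ne_zero (by rw [Ne, map_eq_zero]; exact two_ne_zero) hpot)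
  -- the map to the domain
  let K : ℂ →+* Ω := j.comp k
  have hJ : K Complex.I ^ 2 = -1 := by rw [← map_pow, Complex.I_sq, map_neg, map_one]
  have ha : 2 * K 2⁻¹ = 1 := by
    rw [← map_ofNat K 2, ← map_mul, mul_inv_cancel₀ two_ne_zero, map_one]
  let rr : Fin n × Fin 2 → Ω := fun z => if z.2 = 0 then K 2⁻¹ * (j (u z.1) + j (w z.1))
    else -(K Complex.I * K 2⁻¹) * (j (u z.1) - j (w z.1))
  let pp : Fin n × Fin 2 → Ω := fun z => if z.2 = 0 then K 2⁻¹ * (P z.1 + Q z.1)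
    else -(K Complex.I * K 2⁻¹) * (P z.1 - Q z.1)
  let φ0 : MvPolynomial (NBVar n) ℂ →+* Ω :=
    eval₂Hom K (Sum.elim rr (Sum.elim pp (fun q => j (d q))))
  have fC : ∀ z, φ0 (MvPolynomial.C z) = K z := fun z => eval₂Hom_C _ _ _
  have fr0 : ∀ i, φ0 (rX i 0) = K 2⁻¹ * (j (u i) + j (w i)) := fun i =>
    (eval₂Hom_X' _ _ _).trans (by simp [rr])
  have fr1 : ∀ i, φ0 (rX i 1) = -(K Complex.I * K 2⁻¹) * (j (u i) - j (w i)) := fun i =>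
    (eval₂Hom_X' _ _ _).trans (by simp [rr])
  have fp0 : ∀ i, φ0 (pX i 0) = K 2⁻¹ * (P i + Q i) := fun i =>
    (eval₂Hom_X' _ _ _).trans (by simp [pp])
  have fp1 : ∀ i, φ0 (pX i 1) = -(K Complex.I * K 2⁻¹) * (P i - Q i) := fun i =>
    (eval₂Hom_X' _ _ _).trans (by simp [pp])
  have fd : ∀ q : PairIdx n, φ0 (dX q) = j (d q) := fun q => eval₂Hom_X' _ _ _
  have hφu : IsUnit (φ0 (dProd n)) := by
    rw [dProd, map_prod]
    refine IsUnit.prod_univ_iff.2 (fun q => ?_)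
    rw [fd]
    exact IsUnit.of_mul_eq_one (j (e q)) (by rw [← map_mul, hde, map_one])
  let φ : NBRing n →+* Ω := IsLocalization.Away.lift (dProd n) hφu
  have hφ : ∀ z, φ (toLoc n z) = φ0 z := fun z => IsLocalization.Away.lift_eq (dProd n) hφu z
  have hdu : ∀ q : PairIdx n, IsUnit (toLoc n (dX q)) := fun q => by
    have h1 : IsUnit (toLoc n (dProd n)) := IsLocalization.Away.algebraMap_isUnit (dProd n)
    exact isUnit_of_dvd_unit
      (map_dvd (toLoc n) (Finset.dvd_prod_of_mem (fun q => dX q) (Finset.mem_univ q))) h1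
  have hφe : ∀ q : PairIdx n, φ (Ring.inverse (toLoc n (dX q))) = j (e q) := fun q => by
    have h1 := congrArg φ (Ring.mul_inverse_cancel _ (hdu q))
    rw [map_mul, map_one, hφ, fd] at h1
    have h2 : j (d q) * j (e q) = 1 := by rw [← map_mul, hde, map_one]
    linear_combination j (e q) * h1 - φ (Ring.inverse (toLoc n (dX q))) * h2
  have hKj : ∀ z, j (k z) = K z := fun _ => rfl
  have hus' := congrArg j hus
  have hws' := congrArg j hws
  simp only [map_sum, map_mul, map_zero, hKj] at hus' hws'
  have hC' := hC
  have hH' := hH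
  simp only [map_sum, map_mul, map_add, map_ofNat, hKj] at hC' hH'
  have hle : I ≤ RingHom.ker φ := by
    rw [hI, Ideal.span_le]
    rintro z ((((⟨q, rfl⟩ | ⟨a, rfl⟩) | ⟨a, rfl⟩) | rfl) | rfl)
    · simp only [SetLike.mem_coe, RingHom.mem_ker, hφ, Fin.sum_univ_two, map_sub, map_add,
        map_pow, fr0, fr1, fd]
      have h1 := congrArg j (hdd q)
      simp only [map_mul, map_sub, map_pow] at h1
      rw [h1]
      generalize j (u q.1.1) = U1
      generalize j (u q.1.2) = U2
      generalize j (w q.1.1) = W1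
      generalize j (w q.1.2) = W2
      linear_combination (-(K 2⁻¹) ^ 2 * ((U1 - U2) - (W1 - W2)) ^ 2) * hJ
        - (U1 - U2) * (W1 - W2) * (2 * K 2⁻¹ + 1) * ha
    · simp only [SetLike.mem_coe, RingHom.mem_ker, hφ]
      match a with
      | 0 =>
        simp only [map_sum, map_mul, fC, fr0]
        have e1 : ∀ i, K (m i) * (K 2⁻¹ * (j (u i) + j (w i))) =
            K 2⁻¹ * (K (μ i) * j (u i)) + K 2⁻¹ * (K (μ i) * j (w i)) := fun i => by
          simp only [μ]; ring
        simp only [e1, Finset.sum_add_distrib, ← Finset.mul_sum, hus', hws', mul_zero, add_zero]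
      | 1 =>
        simp only [map_sum, map_mul, fC, fr1]
        have e1 : ∀ i, K (m i) * (-(K Complex.I * K 2⁻¹) * (j (u i) - j (w i))) =
            -(K Complex.I * K 2⁻¹) * (K (μ i) * j (u i)) +
              (K Complex.I * K 2⁻¹) * (K (μ i) * j (w i)) := fun i => by
          simp only [μ]; ring
        simp only [e1, Finset.sum_add_distrib, ← Finset.mul_sum, hus', hws', mul_zero, add_zero]
    · simp only [SetLike.mem_coe, RingHom.mem_ker, hφ]
      match a with
      | 0 =>
        simp only [map_sum, fp0, ← Finset.mul_sum, Finset.sum_add_distrib, hP, hQ, add_zero,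
          mul_zero]
      | 1 =>
        simp only [map_sum, fp1, ← Finset.mul_sum, Finset.sum_sub_distrib, hP, hQ, sub_zero,
          mul_zero]
    · simp only [SetLike.mem_coe, RingHom.mem_ker, hφ, map_sub, map_sum, map_mul, fC, fr0, fr1,
        fp0, fp1]
      have e1 : ∀ i, K 2⁻¹ * (j (u i) + j (w i)) * (-(K Complex.I * K 2⁻¹) * (P i - Q i)) -
          -(K Complex.I * K 2⁻¹) * (j (u i) - j (w i)) * (K 2⁻¹ * (P i + Q i)) =
          -(2 * K Complex.I * K 2⁻¹ ^ 2) * (j (w i) * P i - j (u i) * Q i) := fun i => by ring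
      have e2 : ∑ i, -(2 * K Complex.I * K 2⁻¹ ^ 2) * (j (w i) * P i - j (u i) * Q i) =
          -(2 * K Complex.I * K 2⁻¹ ^ 2) * (2 * K Complex.I * K c) := by
        rw [← Finset.mul_sum, hC']
      rw [Finset.sum_congr rfl (fun i _ => e1 i), e2]
      linear_combination (-4 * K 2⁻¹ ^ 2 * K c) * hJ + K c * (2 * K 2⁻¹ + 1) * ha
    · simp only [SetLike.mem_coe, RingHom.mem_ker, hφ, map_sub, map_sum, map_mul, map_add,
        map_pow, fC, fp0, fp1, hφe]
      have e1 : ∀ i, K (m i : ℂ)⁻¹ * ((K 2⁻¹ * (P i + Q i)) ^ 2 +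
          (-(K Complex.I * K 2⁻¹) * (P i - Q i)) ^ 2) =
          (4 * K 2⁻¹ ^ 2) * (K (μ i)⁻¹ * (P i * Q i)) := fun i => by
        simp only [μ]
        linear_combination (K (m i : ℂ)⁻¹ * K 2⁻¹ ^ 2 * (P i - Q i) ^ 2) * hJ
      have e2 : ∑ i, (4 * K 2⁻¹ ^ 2) * (K (μ i)⁻¹ * (P i * Q i)) = (4 * K 2⁻¹ ^ 2) *
          (2 * (K h + ∑ q : PairIdx n, K (μ q.1.1) * K (μ q.1.2) * j (e q))) := by
        rw [← Finset.mul_sum, hH']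
      rw [Finset.sum_congr rfl (fun i _ => e1 i), e2]
      simp only [μ]
      generalize ∑ q : PairIdx n, K (m q.1.1 : ℂ) * K (m q.1.2 : ℂ) * j (e q) = V
      linear_combination (K h + V) * ((2 * K 2⁻¹) ^ 2 + 2 * K 2⁻¹ + 1) * ha
  -- the map back to the quotient
  let T := NBRing n ⧸ I
  let π : NBRing n →+* T := Ideal.Quotient.mk I
  let θ : MvPolynomial (NBVar n) ℂ →+* T := π.comp (toLoc n)
  let k' : ℂ →+* T := θ.comp MvPolynomial.C
  have hπ0 : ∀ z ∈ I, π z = 0 := fun z hz => Ideal.Quotient.eq_zero_iff_mem.2 hz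
  have hG : ∃ G : Ω →+* T, G.comp φ = π := by
    have hθ : ∀ z, π (toLoc n z) = θ z := fun _ => rfl
    have hk' : ∀ z, θ (MvPolynomial.C z) = k' z := fun _ => rfl
    have R1 : ∀ q : PairIdx n, _ := fun q => hπ0 _ (Ideal.subset_span
      (Or.inl (Or.inl (Or.inl (Or.inl ⟨q, rfl⟩)))))
    have R2 : ∀ a : Fin 2, _ := fun a => hπ0 _ (Ideal.subset_span
      (Or.inl (Or.inl (Or.inl (Or.inr ⟨a, rfl⟩)))))
    have R3 : ∀ a : Fin 2, _ := fun a => hπ0 _ (Ideal.subset_span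
      (Or.inl (Or.inl (Or.inr ⟨a, rfl⟩))))
    have R4 := hπ0 _ (Ideal.subset_span (Or.inl (Or.inr rfl)))
    have R5 := hπ0 _ (Ideal.subset_span (Or.inr rfl))
    have hJ' : k' Complex.I ^ 2 = -1 := by rw [← map_pow, Complex.I_sq, map_neg, map_one]
    have ha' : 2 * k' 2⁻¹ = 1 := by
      rw [← map_ofNat k' 2, ← map_mul, mul_inv_cancel₀ two_ne_zero, map_one]
    simp only [hθ, Fin.sum_univ_two, map_sub, map_add, map_pow, map_sum, map_mul, hk'] at R1 R2 R3 R4 R5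
    let u' : Fin n → T := fun i => θ (rX i 0) + k' Complex.I * θ (rX i 1)
    let w' : Fin n → T := fun i => θ (rX i 0) - k' Complex.I * θ (rX i 1)
    let P' : Fin n → T := fun i => θ (pX i 0) + k' Complex.I * θ (pX i 1)
    let Q' : Fin n → T := fun i => θ (pX i 0) - k' Complex.I * θ (pX i 1)
    let e' : PairIdx n → T := fun q => π (Ring.inverse (toLoc n (dX q)))
    obtain ⟨g, gk, gx, gy, gd, ge⟩ := hu T k' u' w' (fun q => θ (dX q)) e'
      (fun q => by
        simp only [e']
        rw [← hθ, ← map_mul, Ring.mul_inverse_cancel _ (hdu q), map_one])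
      (fun q => by
        simp only [u', w']
        linear_combination R1 q + (θ (rX q.1.1 1) - θ (rX q.1.2 1)) ^ 2 * hJ')
    have gu : ∀ i, g (u i) = u' i := by
      intro i
      have e1 : ∑ l, k' (μ l) * u' l = 0 := by
        have e2 : ∀ l, k' (μ l) * u' l = k' (m l) * θ (rX l 0) +
            k' Complex.I * (k' (m l) * θ (rX l 1)) := fun l => by simp only [u', μ]; ring
        simp only [e2, Finset.sum_add_distrib, ← Finset.mul_sum, R2, mul_zero, add_zero]
      simp only [u, map_sub, map_mul, map_sum, gk, gx, e1, mul_zero, sub_zero]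
    have gw : ∀ i, g (w i) = w' i := by
      intro i
      have e1 : ∑ l, k' (μ l) * w' l = 0 := by
        have e2 : ∀ l, k' (μ l) * w' l = k' (m l) * θ (rX l 0) -
            k' Complex.I * (k' (m l) * θ (rX l 1)) := fun l => by simp only [w', μ]; ring
        simp only [e2, Finset.sum_sub_distrib, ← Finset.mul_sum, R2, mul_zero, sub_zero]
      simp only [w, map_sub, map_mul, map_sum, gk, gy, e1, mul_zero, sub_zero]
    obtain ⟨G, Gj, GP, GQ⟩ := hΩ T g P' Q' ⟨by
        simp only [P', Finset.sum_add_distrib, ← Finset.mul_sum, R3, mul_zero, add_zero], by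
        simp only [Q', Finset.sum_sub_distrib, ← Finset.mul_sum, R3, mul_zero, sub_zero], by
        simp only [gu, gw, gk, map_mul, map_ofNat]
        have e1 : ∀ i, w' i * P' i - u' i * Q' i = 2 * k' Complex.I *
            (θ (rX i 0) * θ (pX i 1) - θ (rX i 1) * θ (pX i 0)) := fun i => by
          simp only [u', w', P', Q']; ring
        simp only [e1, ← Finset.mul_sum]
        rw [sub_eq_zero.1 R4], by
        simp only [gk, map_mul, map_add, map_sum, ge, map_ofNat]
        have e1 : ∀ i, k' (μ i)⁻¹ * (P' i * Q' i) = k' (m i : ℂ)⁻¹ *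
            (θ (pX i 0) ^ 2 + θ (pX i 1) ^ 2) := fun i => by
          simp only [P', Q', μ]
          linear_combination (-k' (m i : ℂ)⁻¹ * θ (pX i 1) ^ 2) * hJ'
        rw [Finset.sum_congr rfl (fun i _ => e1 i)]
        simp only [μ, e']
        linear_combination 2 * R5 - (∑ i, k' (m i : ℂ)⁻¹ *
            (θ (pX i 0) ^ 2 + θ (pX i 1) ^ 2)) * ha'⟩
    have Gj' : ∀ z, G (j z) = g z := fun z => RingHom.congr_fun Gj z
    have GK : ∀ z, G (K z) = k' z := fun z => by rw [← gk, ← Gj']; rfl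
    refine ⟨G, ?_⟩
    refine IsLocalization.ringHom_ext (Submonoid.powers (dProd n)) ?_
    have main : ∀ z, G (φ0 z) = θ z := by
      intro z
      refine RingHom.congr_fun (f := G.comp φ0) (g := θ) ?_ z
      refine MvPolynomial.ringHom_ext ?_ ?_
      · intro z
        rw [RingHom.comp_apply, fC, GK]
        rfl
      · rintro (⟨i, a⟩ | ⟨i, a⟩ | q)
        · match a with
          | 0 =>
            change G (φ0 (rX i 0)) = θ (rX i 0)
            simp only [fr0, map_mul, map_add, GK, Gj', gu, gw, u', w']
            linear_combination θ (rX i 0) * ha'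
          | 1 =>
            change G (φ0 (rX i 1)) = θ (rX i 1)
            simp only [fr1, map_mul, map_sub, map_neg, GK, Gj', gu, gw, u', w']
            linear_combination -2 * k' 2⁻¹ * θ (rX i 1) * hJ' + θ (rX i 1) * ha'
        · match a with
          | 0 =>
            change G (φ0 (pX i 0)) = θ (pX i 0)
            simp only [fp0, map_mul, map_add, GK, GP, GQ, P', Q']
            linear_combination θ (pX i 0) * ha'
          | 1 =>
            change G (φ0 (pX i 1)) = θ (pX i 1)
            simp only [fp1, map_mul, map_sub, map_neg, GK, GP, GQ, P', Q']
            linear_combination -2 * k' 2⁻¹ * θ (pX i 1) * hJ' + θ (pX i 1) * ha'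
        · change G (φ0 (dX q)) = θ (dX q)
          rw [fd, Gj', gd]
    refine RingHom.ext (fun z => ?_)
    change G (φ (toLoc n z)) = π (toLoc n z)
    rw [hφ, main]
    rfl
  obtain ⟨G, hG⟩ := hG
  have hker : I = RingHom.ker φ := by
    refine le_antisymm hle (fun z hz => ?_)
    have h1 := RingHom.congr_fun hG z
    rw [RingHom.comp_apply, (RingHom.mem_ker).1 hz, map_zero] at h1
    exact Ideal.Quotient.eq_zero_iff_mem.1 h1.symm
  rw [hker]
  exact RingHom.ker_isPrime φ
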